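/- Let k ≥ 3 be an integer, ω = exp(2πi/k), and let H be the Hermitian adjacency matrix of a connected mixed graph on a finite nonempty vertex set V, with Δ the maximum degree of the underlying graph. If Δ is an eigenvalue of H, then the underlying graph of H is Δ-regular, and there exists f : V → ZMod k such that for all u, v: if H u v = 1 then f u = f v, and if H u v = ω then f u − f v = 1 in ZMod k. -/

import Mathlib

open Matrix

/-- If `n` complex numbers in the closed unit disc, with `n ≤ d`, sum to `d`, then they are all `1`
and `n = d`. -/
theorem eq_one_of_sum_eq_of_norm_le_one {ι : Type*} (s : Finset ι) (a : ι → ℂ) (d : ℕ)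
    (hcard : s.card ≤ d) (ha : ∀ i ∈ s, ‖a i‖ ≤ 1) (hsum : ∑ i ∈ s, a i = d) :
    s.card = d ∧ ∀ i ∈ s, a i = 1 := by
  have hre : ∀ i ∈ s, 0 ≤ 1 - (a i).re := fun i hi =>
    sub_nonneg.2 ((Complex.re_le_norm _).trans (ha i hi))
  have hsum_re : ∑ i ∈ s, (1 - (a i).re) = s.card - d := by
    have h := congrArg Complex.re hsum
    rw [Complex.re_sum, Complex.natCast_re] at h
    simp [Finset.sum_sub_distrib, h]
  have hd : (s.card : ℝ) ≤ d := by exact_mod_cast hcard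
  have hzero : ∑ i ∈ s, (1 - (a i).re) = 0 :=
    le_antisymm (by linarith) (Finset.sum_nonneg hre)
  refine ⟨by exact_mod_cast (by linarith : (s.card : ℝ) = d), fun i hi => ?_⟩
  have h1 : (a i).re = 1 := by linarith [(Finset.sum_eq_zero_iff_of_nonneg hre).1 hzero i hi]
  have h2 : (a i).re * (a i).re + (a i).im * (a i).im ≤ 1 := by
    rw [← Complex.normSq_apply, Complex.normSq_eq_norm_sq]
    exact pow_le_one₀ (norm_nonneg _) (ha i hi)
  have h3 : (a i).im = 0 := by
    rw [h1] at h2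
    exact mul_self_eq_zero.1 (le_antisymm (by linarith) (mul_self_nonneg _))
  exact Complex.ext h1 h3

/-- A property preserved along the edges of a connected graph holds everywhere once it holds
somewhere. -/
theorem SimpleGraph.Connected.forall_of_adj {V : Type*} {G : SimpleGraph V} (hG : G.Connected)
    {P : V → Prop} (hP : ∀ u v, G.Adj u v → P u → P v) {r : V} (hr : P r) (v : V) : P v := by
  obtain ⟨p⟩ := hG.preconnected r v
  induction p with
  | nil => exact hr
  | cons h _ ih => exact ih (hP _ _ h hr)

/-- If the maximum degree is an eigenvalue of a matrix supported on the edges of a connected graph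
with entries in the closed unit disc, then the graph is regular, and any eigenvector is nowhere zero
and constant along edges up to the matrix entries. -/
theorem isRegular_and_mul_eq_of_mulVec_eq_maxDegree {V : Type*} [Fintype V] (H : Matrix V V ℂ)
    (G : SimpleGraph V) [DecidableRel G.Adj] (hconn : G.Connected)
    (hsupp : ∀ u v, ¬ G.Adj u v → H u v = 0) (hnorm : ∀ u v, ‖H u v‖ ≤ 1)
    (x : V → ℂ) (hx : x ≠ 0) (heig : H.mulVec x = (G.maxDegree : ℂ) • x) :
    G.IsRegularOfDegree G.maxDegree ∧ (∀ u, x u ≠ 0) ∧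
      ∀ u v, G.Adj u v → H u v * x v = x u := by
  obtain ⟨w, hw⟩ := Function.ne_iff.1 hx
  have : Nonempty V := ⟨w⟩
  obtain ⟨r, hr⟩ := Finite.exists_max fun v => ‖x v‖
  have hr0 : 0 < ‖x r‖ := (norm_pos_iff.2 hw).trans_le (hr w)
  have local_eq : ∀ u, ‖x u‖ = ‖x r‖ →
      G.degree u = G.maxDegree ∧ ∀ v, G.Adj u v → H u v * x v = x u := by
    intro u hu
    have hu0 : x u ≠ 0 := norm_pos_iff.1 (hu ▸ hr0)
    have hsum : ∑ v ∈ G.neighborFinset u, H u v * x v / x u = (G.maxDegree : ℂ) := by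
      rw [← Finset.sum_div, div_eq_iff hu0]
      refine Eq.trans ?_ (congrFun heig u)
      refine Finset.sum_subset (Finset.subset_univ _) fun v _ hv => ?_
      rw [hsupp u v (by simpa using hv), zero_mul]
    obtain ⟨hdeg, hone⟩ := eq_one_of_sum_eq_of_norm_le_one _ _ _ (G.degree_le_maxDegree u)
      (fun v _ => by
        rw [norm_div, norm_mul, hu, div_le_one hr0]
        exact (mul_le_of_le_one_left (norm_nonneg _) (hnorm u v)).trans (hr v)) hsum
    refine ⟨hdeg, fun v hv => ?_⟩
    simpa [div_eq_one_iff_eq hu0] using hone v (by simpa using hv)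
  have hmax : ∀ u, ‖x u‖ = ‖x r‖ := by
    refine hconn.forall_of_adj (fun u v huv hu => le_antisymm (hr v) ?_) (r := r) rfl
    rw [← hu, ← (local_eq u hu).2 v huv, norm_mul]
    exact mul_le_of_le_one_left (norm_nonneg _) (hnorm u v)
  exact ⟨fun u => (local_eq u (hmax u)).1, fun u => norm_pos_iff.1 ((hmax u).symm ▸ hr0),
    fun u => (local_eq u (hmax u)).2⟩

/-- If `Δ` (the maximum degree of the underlying graph) is an eigenvalue of the Hermitian
adjacency matrix of a connected mixed graph `H`, then the underlying graph is `Δ`-regular and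
the vertex set admits a partition `f : V → ZMod k` such that undirected edges stay within a
class and arcs go from class `s+1` to class `s`. -/
theorem stmt_10 {V : Type*} [Fintype V] [DecidableEq V] [Nonempty V]
    (k : ℕ) (hk : 3 ≤ k) (ω : ℂ)
    (hω : ω = Complex.exp (2 * (Real.pi : ℂ) * Complex.I / (k : ℂ)))
    (H : Matrix V V ℂ) (hherm : H.IsHermitian) (hdiag : ∀ v, H v v = 0)
    (hent : ∀ u v, H u v ∈ ({0, 1, ω, (starRingEnd ℂ) ω} : Set ℂ))
    (G : SimpleGraph V) [DecidableRel G.Adj]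
    (hadj : ∀ u v, G.Adj u v ↔ u ≠ v ∧ H u v ≠ 0)
    (hconn : G.Connected)
    (heig : ∃ x : V → ℂ, x ≠ 0 ∧ H.mulVec x = (G.maxDegree : ℂ) • x) :
    G.IsRegularOfDegree G.maxDegree ∧
      ∃ f : V → ZMod k, ∀ u v,
        (H u v = 1 → f u = f v) ∧ (H u v = ω → f u - f v = 1) := by
  obtain ⟨x, hx0, hx⟩ := heig
  have hk0 : k ≠ 0 := by omega
  have hprim : IsPrimitiveRoot ω k := hω ▸ Complex.isPrimitiveRoot_exp k hk0
  have hω0 : ω ≠ 0 := hprim.ne_zero hk0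
  have hω1 : ‖ω‖ = 1 := hprim.norm'_eq_one hk0
  have hconj : (starRingEnd ℂ) ω = ω⁻¹ := (Complex.inv_eq_conj hω1).symm
  simp only [hconj, Set.mem_insert_iff, Set.mem_singleton_iff] at hent
  have hadj_of_ne : ∀ u v, H u v ≠ 0 → G.Adj u v := fun u v h =>
    (hadj u v).2 ⟨fun huv => h (huv ▸ hdiag u), h⟩
  obtain ⟨hreg, hne, hmul⟩ := isRegular_and_mul_eq_of_mulVec_eq_maxDegree H G hconn
    (fun u v h => not_not.1 fun h0 => h (hadj_of_ne u v h0))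
    (fun u v => by rcases hent u v with h | h | h | h <;> simp [h, hω1]) x hx0 hx
  obtain ⟨r⟩ := ‹Nonempty V›
  have hpow : ∀ u, ∃ n : ℤ, x u = ω ^ n * x r := by
    refine hconn.forall_of_adj ?_ (r := r) ⟨0, by simp⟩
    rintro u v huv ⟨n, hn⟩
    have hvu := hmul v u huv.symm
    rw [hn] at hvu
    rcases hent v u with h | h | h | h
    · exact absurd h ((hadj v u).1 huv.symm).2
    · exact ⟨n, by rw [← hvu, h, one_mul]⟩
    · exact ⟨1 + n, by rw [← hvu, h, zpow_add₀ hω0, zpow_one, mul_assoc]⟩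
    · exact ⟨-1 + n, by rw [← hvu, h, zpow_add₀ hω0, _root_.zpow_neg_one, mul_assoc]⟩
  choose n hn using hpow
  have hcast : ∀ (m : ℤ) (u v : V), H u v = ω ^ m → (n u : ZMod k) - n v = m := by
    intro m u v h
    have huv := hmul u v (hadj_of_ne u v (h ▸ zpow_ne_zero m hω0))
    rw [h, hn u, hn v, ← mul_assoc, ← zpow_add₀ hω0] at huv
    have hz : ω ^ (n u - n v - m) = 1 := by
      rw [sub_sub, add_comm (n v) m, zpow_sub₀ hω0, mul_right_cancel₀ (hne r) huv,
        div_self (zpow_ne_zero _ hω0)]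
    have := (ZMod.intCast_zmod_eq_zero_iff_dvd _ k).2 ((hprim.zpow_eq_one_iff_dvd _).1 hz)
    push_cast at this
    exact sub_eq_zero.1 this
  refine ⟨hreg, fun u => n u, fun u v => ⟨fun h => ?_, fun h => ?_⟩⟩
  · exact sub_eq_zero.1 (by simpa using hcast 0 u v (by simpa using h))
  · simpa using hcast 1 u v (by simpa using h)
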